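/- Let X and Y be CAT(0) cube complexes with no extremal vertices, let f : ∂X → ∂Y be a Möbius bijection, and let x1, x2, x ∈ ∂X satisfy x1 op_x x2. Set m_x := m(x1,x2,x) ∈ X and m'_x := m(f(x1),f(x2),f(x)); then m'_x ∈ Y, and for every u ∈ ∂X with (x1,x2,x,u) ∈ 𝒜(X) one has (x1·u)_{m_x} = (f(x1)·f(u))_{m'_x}, (x2·u)_{m_x} = (f(x2)·f(u))_{m'_x}, and (x·u)_{m_x} = (f(x)·f(u))_{m'_x}. -/

import Mathlib

/-!
We use the standard combinatorial model of a CAT(0) cube complex: it is identified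
with its vertex set endowed with the combinatorial (ℓ¹) metric, i.e. with a median
graph `G` on a vertex type `V`.  Halfspaces are realised as the vertex sets of the
two sides of the hyperplane dual to an edge, the Roller compactification `X̄` is the
set of ultrafilters of halfspaces, vertices embedding via principal ultrafilters,
and the Roller boundary `∂X` consists of the non-principal ultrafilters.
-/

open scoped ENNReal
open Set

namespace CCCR

variable {V V' : Type*}

/-- The interval between two vertices w.r.t. the combinatorial metric. -/
def vInterval (G : SimpleGraph V) (u v : V) : Set V :=
  {w : V | G.dist u w + G.dist w v = G.dist u v}

/-- Combinatorial model of a CAT(0) cube complex (identified with its vertex set,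
endowed with the combinatorial metric): a connected median graph. -/
def IsCCC (G : SimpleGraph V) : Prop :=
  G.Connected ∧ ∀ x y z : V, ∃! m : V,
    m ∈ vInterval G x y ∧ m ∈ vInterval G y z ∧ m ∈ vInterval G z x

/-- Halfspaces of the cube complex: the sides of the hyperplane dual to an edge. -/
def IsHalfspace (G : SimpleGraph V) (h : Set V) : Prop :=
  ∃ u v : V, G.Adj u v ∧ h = {w : V | G.dist w v < G.dist w u}

/-- The halfspace dual to the (oriented) edge `(u,v)` containing `v`. -/
def edgeHalf (G : SimpleGraph V) (u v : V) : Set V :=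
  {w : V | G.dist w v < G.dist w u}

/-- The hyperplane (wall) dual to the edge `(u,v)`, recorded as its pair of sides. -/
def wallOf (G : SimpleGraph V) (u v : V) : Set (Set V) :=
  {edgeHalf G u v, (edgeHalf G u v)ᶜ}

/-- Two (necessarily distinct) hyperplanes, with respective sides `h` and `k`,
are transverse: all four quarter-spaces are nonempty. -/
def Transv (h k : Set V) : Prop :=
  (h ∩ k).Nonempty ∧ (h ∩ kᶜ).Nonempty ∧ (hᶜ ∩ k).Nonempty ∧ (hᶜ ∩ kᶜ).Nonempty

/-- An ultrafilter of halfspaces: a point of the Roller compactification X̄.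
It contains exactly one side of each hyperplane, and any two members intersect. -/
def IsUltra (G : SimpleGraph V) (σ : Set (Set V)) : Prop :=
  (∀ h ∈ σ, IsHalfspace G h) ∧
  (∀ h : Set V, IsHalfspace G h → (h ∈ σ ↔ hᶜ ∉ σ)) ∧
  (∀ h ∈ σ, ∀ k ∈ σ, (h ∩ k).Nonempty)

/-- The principal ultrafilter of a vertex, i.e. the image of `v` in X̄. -/
def princ (G : SimpleGraph V) (v : V) : Set (Set V) :=
  {h : Set V | IsHalfspace G h ∧ v ∈ h}

/-- A point of the Roller boundary ∂X = X̄ ∖ X: a non-principal ultrafilter. -/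
def IsBdryPt (G : SimpleGraph V) (σ : Set (Set V)) : Prop :=
  IsUltra G σ ∧ ∀ v : V, σ ≠ princ G v

/-- The Roller boundary ∂X as a type. -/
abbrev Bdry (G : SimpleGraph V) : Type _ := {σ : Set (Set V) // IsBdryPt G σ}

/-- The Gromov product (x·y)_v = #𝒲(v | x, y) ∈ ℕ ∪ {+∞}, counted through the
sides containing both x and y but not v. -/
noncomputable def grom (_G : SimpleGraph V) (v : V) (x y : Set (Set V)) : ℕ∞ :=
  {h : Set V | h ∈ x ∧ h ∈ y ∧ v ∉ h}.encard

/-- The embedding ℕ ∪ {+∞} → ℤ ∪ {±∞}. -/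
noncomputable def toE (n : ℕ∞) : EReal := ((n : ℝ≥0∞) : EReal)

/-- The cross ratio cr_v(x,y,z,w) = (x·z)_v + (y·w)_v − (x·w)_v − (y·z)_v ∈ ℤ ∪ {±∞}. -/
noncomputable def crv (G : SimpleGraph V) (v : V) (x y z w : Set (Set V)) : EReal :=
  toE (grom G v x z) + toE (grom G v y w) - toE (grom G v x w) - toE (grom G v y z)

/-- The triple of sums of Gromov products attached to a 4-tuple. -/
noncomputable def tripod (G : SimpleGraph V) (v : V) (x y z w : Set (Set V)) :
    ℕ∞ × ℕ∞ × ℕ∞ :=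
  (grom G v x y + grom G v z w, grom G v x z + grom G v y w, grom G v x w + grom G v y z)

/-- (x,y,z,w) ∈ 𝒜 w.r.t. the basepoint v: at most one of the three sums is infinite. -/
def inA (G : SimpleGraph V) (v : V) (x y z w : Set (Set V)) : Prop :=
  ((tripod G v x y z w).1 ≠ ⊤ ∧ (tripod G v x y z w).2.1 ≠ ⊤) ∨
  ((tripod G v x y z w).1 ≠ ⊤ ∧ (tripod G v x y z w).2.2 ≠ ⊤) ∨
  ((tripod G v x y z w).2.1 ≠ ⊤ ∧ (tripod G v x y z w).2.2 ≠ ⊤)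

/-- (x,y,z,w) ∈ 𝒜 (this is independent of the basepoint). -/
def memA (G : SimpleGraph V) (x y z w : Set (Set V)) : Prop :=
  ∀ v : V, inA G v x y z w

/-- Two triples in (ℕ ∪ {+∞})³ are equivalent if they differ by adding a constant
n ∈ ℕ to all three entries. -/
def TripEquiv (p q : ℕ∞ × ℕ∞ × ℕ∞) : Prop :=
  (∃ n : ℕ, p.1 = q.1 + (n : ℕ∞) ∧ p.2.1 = q.2.1 + (n : ℕ∞) ∧ p.2.2 = q.2.2 + (n : ℕ∞)) ∨
  (∃ n : ℕ, q.1 = p.1 + (n : ℕ∞) ∧ q.2.1 = p.2.1 + (n : ℕ∞) ∧ q.2.2 = p.2.2 + (n : ℕ∞))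

/-- crt(x,y,z,w) = ⟪a:b:c⟫ (the cross ratio triple is independent of the basepoint,
so we require the equality of classes at every basepoint). -/
def crtEq (G : SimpleGraph V) (x y z w : Set (Set V)) (a b c : ℕ∞) : Prop :=
  ∀ v : V, TripEquiv (tripod G v x y z w) (a, b, c)

/-- The median of three points of X̄. -/
def med (x y z : Set (Set V)) : Set (Set V) := (x ∩ y) ∪ (y ∩ z) ∪ (z ∩ x)

/-- The interval I(x,y) ⊆ X̄ between two points of X̄. -/
def rInterval (G : SimpleGraph V) (x y : Set (Set V)) : Set (Set (Set V)) :=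
  {σ : Set (Set V) | IsUltra G σ ∧ x ∩ y ⊆ σ}

/-- `Op G x y z` : x and y are opposite with respect to z, i.e. the median
m = m(x,y,z) lies in X and I(x,y) = I(x,m) ∪ I(m,y). -/
def Op (G : SimpleGraph V) (x y z : Set (Set V)) : Prop :=
  (∃ p : V, med x y z = princ G p) ∧
  rInterval G x y = rInterval G x (med x y z) ∪ rInterval G (med x y z) y

/-- A geodesic ray (based at `r 0`). -/
def IsGeodRay (G : SimpleGraph V) (r : ℕ → V) : Prop :=
  (∀ n : ℕ, G.Adj (r n) (r (n + 1))) ∧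
  ∀ m n : ℕ, m ≤ n → G.dist (r m) (r n) = n - m

/-- A bi-infinite geodesic line. -/
def IsGeodLine (G : SimpleGraph V) (L : ℤ → V) : Prop :=
  (∀ n : ℤ, G.Adj (L n) (L (n + 1))) ∧
  ∀ m n : ℤ, m ≤ n → (G.dist (L m) (L n) : ℤ) = n - m

/-- The set 𝒲(r) of hyperplanes crossed by (the edges of) a ray. -/
def rayWalls (G : SimpleGraph V) (r : ℕ → V) : Set (Set (Set V)) :=
  {W : Set (Set V) | ∃ n : ℕ, W = wallOf G (r n) (r (n + 1))}

/-- A hyperplane is adjacent to `v` if it is dual to an edge incident to `v`. -/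
def WallAdjTo (G : SimpleGraph V) (v : V) (W : Set (Set V)) : Prop :=
  ∃ u : V, G.Adj v u ∧ W = wallOf G v u

/-- A straight ray: no two of the hyperplanes it crosses are transverse. -/
def RayStraight (G : SimpleGraph V) (r : ℕ → V) : Prop :=
  ∀ m n : ℕ, ¬ Transv (edgeHalf G (r m) (r (m + 1))) (edgeHalf G (r n) (r (n + 1)))

/-- A straight line: no two of the hyperplanes it crosses are transverse. -/
def LineStraight (G : SimpleGraph V) (L : ℤ → V) : Prop :=
  ∀ m n : ℤ, ¬ Transv (edgeHalf G (L m) (L (m + 1))) (edgeHalf G (L n) (L (n + 1)))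

/-- The endpoint at infinity r⁺ ∈ ∂X of a ray: the ultrafilter of those halfspaces
containing all but finitely many of its vertices. -/
def rayEnd (G : SimpleGraph V) (r : ℕ → V) : Set (Set V) :=
  {h : Set V | IsHalfspace G h ∧ ∃ N : ℕ, ∀ n : ℕ, N ≤ n → r n ∈ h}

/-- A straight point of the Roller boundary: the endpoint at infinity of a straight ray. -/
def IsStraightPt (G : SimpleGraph V) (x : Set (Set V)) : Prop :=
  ∃ r : ℕ → V, IsGeodRay G r ∧ RayStraight G r ∧ rayEnd G r = x

/-- x and y are the two endpoints at infinity of the line L. -/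
def LineEnds (G : SimpleGraph V) (L : ℤ → V) (x y : Set (Set V)) : Prop :=
  rayEnd G (fun n : ℕ => L (n : ℤ)) = x ∧ rayEnd G (fun n : ℕ => L (-(n : ℤ))) = y

/-- The edges from `v` to `a` and from `v` to `b` span a square. -/
def SpansSquare (G : SimpleGraph V) (v a b : V) : Prop :=
  ∃ w : V, w ≠ v ∧ G.Adj a w ∧ G.Adj b w

/-- An extremal vertex: some edge at `v` spans a square with every other edge at `v`. -/
def Extremal (G : SimpleGraph V) (v : V) : Prop :=
  ∃ a : V, G.Adj v a ∧ ∀ b : V, G.Adj v b → b ≠ a → SpansSquare G v a b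

/-- The cube complex has no extremal vertices. -/
def NoExtremal (G : SimpleGraph V) : Prop := ∀ v : V, ¬ Extremal G v

/-- A skinny vertex: exactly two incident edges. -/
def Skinny (G : SimpleGraph V) (v : V) : Prop := {u : V | G.Adj v u}.encard = 2

/-- A skinny ray: a geodesic ray whose initial vertex has at least three incident
edges and all of whose other vertices are skinny. -/
def IsSkinnyRay (G : SimpleGraph V) (r : ℕ → V) : Prop :=
  IsGeodRay G r ∧ 3 ≤ {u : V | G.Adj (r 0) u}.encard ∧ ∀ n : ℕ, 1 ≤ n → Skinny G (r n)

/-- (The vertex set of) a cube of the complex: a subset inducing a hypercube graph. -/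
def IsCube (G : SimpleGraph V) (c : Set V) : Prop :=
  ∃ (n : ℕ) (e : c ≃ (Fin n → Bool)),
    ∀ a b : c, G.Adj (a : V) (b : V) ↔ ∃! i : Fin n, e a i ≠ e b i

/-- A maximal cube. -/
def IsMaxCube (G : SimpleGraph V) (c : Set V) : Prop :=
  IsCube G c ∧ ∀ c' : Set V, IsCube G c' → c ⊆ c' → c' = c

/-- Completeness: there is no infinite ascending chain of cubes. -/
def CubeComplete (G : SimpleGraph V) : Prop :=
  ¬ ∃ c : ℕ → Set V, (∀ n : ℕ, IsCube G (c n)) ∧ ∀ n : ℕ, c n ⊂ c (n + 1)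

/-- No free faces: no non-maximal cube is contained in a unique maximal cube. -/
def NoFreeFaces (G : SimpleGraph V) : Prop :=
  ∀ c : Set V, IsCube G c → ¬ IsMaxCube G c → ¬ ∃! m : Set V, IsMaxCube G m ∧ c ⊆ m

/-- #𝒲(x, z | y, w): the number of hyperplanes separating x and z from y and w,
counted through the sides containing x and z. -/
noncomputable def sepCount (x z y w : Set (Set V)) : ℕ∞ :=
  {h : Set V | h ∈ x ∧ h ∈ z ∧ h ∉ y ∧ h ∉ w}.encard

/-- A Möbius map between Roller boundaries: it maps 𝒜(X) into 𝒜(Y) and preserves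
cross ratios. -/
def Mobius (G : SimpleGraph V) (G' : SimpleGraph V') (f : Bdry G → Bdry G') : Prop :=
  ∀ x y z w : Bdry G, memA G x.1 y.1 z.1 w.1 →
    memA G' (f x).1 (f y).1 (f z).1 (f w).1 ∧
    ∀ (v : V) (v' : V'),
      crv G' v' (f x).1 (f y).1 (f z).1 (f w).1 = crv G v x.1 y.1 z.1 w.1

/-- The induced action of a cubical isomorphism on X̄: an ultrafilter is mapped to
the set of images of its halfspaces. -/
def mapUltra (φ : V → V') (σ : Set (Set V)) : Set (Set V') :=
  (fun h : Set V => φ '' h) '' σ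

/-- The standard cubulation of ℝ: vertex set ℤ, edges between consecutive integers. -/
def zline : SimpleGraph ℤ := SimpleGraph.fromRel (fun m n => n = m + 1)

end CCCR

namespace CCCR
section graph
variable {V : Type*} {G : SimpleGraph V}

lemma ccc_conn (hG : IsCCC G) : G.Connected := hG.1

lemma ccc_med (hG : IsCCC G) (x y z : V) : ∃ m, G.dist x m + G.dist m y = G.dist x y ∧
    G.dist y m + G.dist m z = G.dist y z ∧ G.dist z m + G.dist m x = G.dist z x := by
  obtain ⟨m, hm, -⟩ := hG.2 x y z
  exact ⟨m, hm⟩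

lemma ccc_ne (hG : IsCCC G) {u v : V} (h : G.Adj u v) (w : V) : G.dist w u ≠ G.dist w v := by
  intro he
  obtain ⟨m, h1, h2, h3⟩ := ccc_med hG u v w
  have d1 : G.dist u v = 1 := SimpleGraph.dist_eq_one_iff_adj.2 h
  have c1 := G.dist_comm (u := w) (v := m)
  have c2 := G.dist_comm (u := u) (v := m)
  have c3 := G.dist_comm (u := v) (v := m)
  have c4 := G.dist_comm (u := v) (v := w)
  omega

lemma ccc_adj_tri (hG : IsCCC G) {u v : V} (h : G.Adj u v) (w : V) :
    G.dist w u + 1 = G.dist w v ∨ G.dist w v + 1 = G.dist w u := by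
  have d1 : G.dist u v = 1 := SimpleGraph.dist_eq_one_iff_adj.2 h
  have := (ccc_conn hG).dist_triangle (u := w) (v := u) (w := v)
  have := (ccc_conn hG).dist_triangle (u := w) (v := v) (w := u)
  have := ccc_ne hG h w
  have := G.dist_comm (u := u) (v := v)
  omega

/-- quadrangle condition -/
lemma ccc_quad (hG : IsCCC G) {v a b z : V} (ha : G.Adj v a) (hb : G.Adj v b) (hab : a ≠ b)
    (h1 : G.dist z a + 1 = G.dist z v) (h2 : G.dist z b + 1 = G.dist z v) :
    ∃ w, G.Adj a w ∧ G.Adj b w ∧ G.dist z w + 2 = G.dist z v := by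
  obtain ⟨m, m1, m2, m3⟩ := ccc_med hG a b z
  have d1 : G.dist v a = 1 := SimpleGraph.dist_eq_one_iff_adj.2 ha
  have d2 : G.dist v b = 1 := SimpleGraph.dist_eq_one_iff_adj.2 hb
  have := (ccc_conn hG).dist_triangle (u := a) (v := v) (w := b)
  have := (ccc_conn hG).pos_dist_of_ne hab
  have := G.dist_comm (u := v) (v := a)
  have := G.dist_comm (u := z) (v := m)
  have := G.dist_comm (u := z) (v := b)
  have := G.dist_comm (u := a) (v := m)
  have := G.dist_comm (u := b) (v := m)
  refine ⟨m, SimpleGraph.dist_eq_one_iff_adj.1 ?_, SimpleGraph.dist_eq_one_iff_adj.1 ?_, ?_⟩ <;> omega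

lemma edgeHalf_compl (hG : IsCCC G) {u v : V} (h : G.Adj u v) :
    (edgeHalf G u v)ᶜ = edgeHalf G v u := by
  ext w
  have := ccc_ne hG h w
  simp only [edgeHalf, mem_compl_iff, mem_ofPred_eq]
  omega

/-- one inclusion for opposite sides of a square -/
lemma square_half_sub (hG : IsCCC G) {a b a' w : V} (h1 : G.Adj a b) (h2 : G.Adj a a')
    (h3 : G.Adj a' w) (h4 : G.Adj b w) (haw : a ≠ w) (hab : a' ≠ b) :
    edgeHalf G a b ⊆ edgeHalf G a' w := by
  intro z hz
  by_contra hz'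
  simp only [edgeHalf, mem_ofPred_eq] at hz hz'
  have t1 := ccc_adj_tri hG h1 z
  have t2 := ccc_adj_tri hG h2 z
  have t3 := ccc_adj_tri hG h3 z
  have t4 := ccc_adj_tri hG h4 z
  obtain ⟨y, y1, y2, y3⟩ := ccc_quad hG (z := z) h2 h1 hab (by omega) (by omega)
  have nya : y ≠ a := by rintro rfl; omega
  have nyw : y ≠ w := by rintro rfl; omega
  obtain ⟨m, -, hu⟩ := hG.2 a w y
  have key : ∀ {p q r : V}, G.Adj p q → G.Adj q r → p ≠ r → q ∈ vInterval G p r := by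
    intro p q r hp hq hn
    have e1 : G.dist p q = 1 := SimpleGraph.dist_eq_one_iff_adj.2 hp
    have e2 : G.dist q r = 1 := SimpleGraph.dist_eq_one_iff_adj.2 hq
    have e3 := (ccc_conn hG).pos_dist_of_ne hn
    have e4 := (ccc_conn hG).dist_triangle (u := p) (v := q) (w := r)
    have e5 := ccc_ne hG hq p
    simp only [vInterval, mem_ofPred_eq]
    omega
  have e1 := hu a' ⟨key h2 h3 haw, key h3.symm y1 nyw.symm, key y1.symm h2.symm nya⟩
  have e2 := hu b ⟨key h1 h4 haw, key h4.symm y2 nyw.symm, key y2.symm h1.symm nya⟩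
  exact hab (e1.trans e2.symm)

lemma square_half (hG : IsCCC G) {a b a' w : V} (h1 : G.Adj a b) (h2 : G.Adj a a')
    (h3 : G.Adj a' w) (h4 : G.Adj b w) (haw : a ≠ w) (hab : a' ≠ b) :
    edgeHalf G a b = edgeHalf G a' w :=
  Subset.antisymm (square_half_sub hG h1 h2 h3 h4 haw hab)
    (square_half_sub hG h3 h2.symm h1 h4.symm hab haw)

lemma exists_step (hG : IsCCC G) {u a : V} (h : u ≠ a) :
    ∃ a', G.Adj a a' ∧ G.dist u a' + 1 = G.dist u a := by
  obtain ⟨p, hp⟩ := (ccc_conn hG).exists_walk_length_eq_dist a u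
  cases p with
  | nil => exact absurd rfl h
  | cons hadj q =>
    rename_i a'
    refine ⟨a', hadj, ?_⟩
    have := SimpleGraph.dist_le q
    have := ccc_adj_tri hG hadj u
    simp only [SimpleGraph.Walk.length_cons] at hp
    have := G.dist_comm (u := u) (v := a)
    have := G.dist_comm (u := u) (v := a')
    omega

lemma half_eq_aux (hG : IsCCC G) (n : ℕ) : ∀ {a b u v : V}, G.Adj a b → G.Adj u v →
    G.dist u a = n → G.dist v b < G.dist v a → G.dist u a < G.dist u b →
    edgeHalf G u v = edgeHalf G a b := by
  induction n with
  | zero =>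
    intro a b u v hab huv hn h1 h2
    have t1 := ccc_adj_tri hG hab v
    have t4 := ccc_adj_tri hG huv a
    have := G.dist_comm (u := u) (v := a)
    have := G.dist_comm (u := v) (v := a)
    have e1 : u = a := (ccc_conn hG).dist_eq_zero_iff.1 hn
    have e2 : v = b := (ccc_conn hG).dist_eq_zero_iff.1 (by omega)
    rw [e1, e2]
  | succ n ih =>
    intro a b u v hab huv hn h1 h2
    have t1 := ccc_adj_tri hG hab v
    have t2 := ccc_adj_tri hG hab u
    have t3 := ccc_adj_tri hG huv a
    have t4 := ccc_adj_tri hG huv b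
    have c1 := G.dist_comm (u := u) (v := a)
    have c2 := G.dist_comm (u := v) (v := a)
    have c3 := G.dist_comm (u := u) (v := b)
    have c4 := G.dist_comm (u := v) (v := b)
    have hne : u ≠ a := by rintro rfl; simp at hn
    obtain ⟨a', ha', hd⟩ := exists_step hG hne
    have t5 := ccc_adj_tri hG huv a'
    have t6 := ccc_adj_tri hG ha' v
    have c5 := G.dist_comm (u := u) (v := a')
    have c6 := G.dist_comm (u := v) (v := a')
    have hn' : a' ≠ b := by rintro rfl; omega
    obtain ⟨w, w1, w2, w3⟩ := ccc_quad hG (z := v) ha' hab hn' (by omega) (by omega)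
    have hw : a ≠ w := by rintro rfl; omega
    rw [square_half hG hab ha' w1 w2 hw hn']
    have t7 := ccc_adj_tri hG w2 u
    exact ih w1 huv (by omega) (by omega) (by omega)

lemma isHalf_edge {u v : V} (h : G.Adj u v) : IsHalfspace G (edgeHalf G u v) := ⟨u, v, h, rfl⟩

lemma half_eq (hG : IsCCC G) {h : Set V} (hh : IsHalfspace G h) {u v : V} (huv : G.Adj u v)
    (hu : u ∉ h) (hv : v ∈ h) : h = edgeHalf G u v := by
  obtain ⟨a, b, hab, rfl⟩ := hh
  simp only [mem_ofPred_eq] at hu hv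
  have := ccc_ne hG hab u
  exact (half_eq_aux hG _ hab huv rfl hv (by omega)).symm

lemma half_compl (hG : IsCCC G) {h : Set V} (hh : IsHalfspace G h) : IsHalfspace G hᶜ := by
  obtain ⟨a, b, hab, rfl⟩ := hh
  exact ⟨b, a, hab.symm, edgeHalf_compl hG hab⟩

lemma half_nonempty (hG : IsCCC G) {h : Set V} (hh : IsHalfspace G h) : h.Nonempty := by
  obtain ⟨a, b, hab, rfl⟩ := hh
  exact ⟨b, by simp [(ccc_conn hG).pos_dist_of_ne hab.symm.ne]⟩

lemma mem_edgeHalf_right (hG : IsCCC G) {u v : V} (h : G.Adj u v) : v ∈ edgeHalf G u v := by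
  simp [edgeHalf, (ccc_conn hG).pos_dist_of_ne h.symm.ne]

lemma not_mem_edgeHalf_left {u v : V} : u ∉ edgeHalf G u v := by
  simp [edgeHalf]

/-- a geodesic from inside to outside crosses -/
lemma exists_cross (hG : IsCCC G) {h : Set V} {x : V} (hx : x ∈ h) : ∀ (n : ℕ) (z : V),
    G.dist x z = n → z ∉ h → ∃ p q, p ∈ h ∧ q ∉ h ∧ G.Adj p q ∧
      G.dist x p + 1 + G.dist q z = G.dist x z := by
  intro n
  induction n with
  | zero =>
    intro z hz hzh
    exact absurd ((ccc_conn hG).dist_eq_zero_iff.1 hz ▸ hx) hzh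
  | succ n ih =>
    intro z hz hzh
    have hne : x ≠ z := by rintro rfl; exact hzh hx
    obtain ⟨z', hz', hd⟩ := exists_step hG hne
    by_cases hm : z' ∈ h
    · exact ⟨z', z, hm, hzh, hz'.symm, by simp; omega⟩
    · obtain ⟨p, q, hp, hq, hpq, hd'⟩ := ih z' (by omega) hm
      refine ⟨p, q, hp, hq, hpq, ?_⟩
      have e1 : G.dist z' z = 1 := SimpleGraph.dist_eq_one_iff_adj.2 hz'.symm
      have e2 : G.dist p q = 1 := SimpleGraph.dist_eq_one_iff_adj.2 hpq
      have := (ccc_conn hG).dist_triangle (u := q) (v := z') (w := z)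
      have := (ccc_conn hG).dist_triangle (u := x) (v := p) (w := z)
      have := (ccc_conn hG).dist_triangle (u := p) (v := q) (w := z)
      omega

lemma half_convex (hG : IsCCC G) {h : Set V} (hh : IsHalfspace G h) {x y z : V} (hx : x ∈ h)
    (hy : y ∈ h) (hz : G.dist x z + G.dist z y = G.dist x y) : z ∈ h := by
  by_contra hzh
  obtain ⟨p, q, hp, hq, hpq, h1⟩ := exists_cross hG hx _ z rfl hzh
  obtain ⟨s, r, hs, hr, hsr, h2⟩ := exists_cross hG hy _ z rfl hzh
  have he := half_eq hG hh hpq.symm hq hp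
  rw [he] at hs
  simp only [edgeHalf, mem_ofPred_eq] at hs
  have e2 : G.dist s r = 1 := SimpleGraph.dist_eq_one_iff_adj.2 hsr
  have := (ccc_conn hG).dist_triangle (u := s) (v := r) (w := q)
  have := (ccc_conn hG).dist_triangle (u := r) (v := z) (w := q)
  have := (ccc_conn hG).dist_triangle (u := x) (v := p) (w := y)
  have := (ccc_conn hG).dist_triangle (u := p) (v := s) (w := y)
  have := G.dist_comm (u := q) (v := z)
  have := G.dist_comm (u := p) (v := s)
  have := G.dist_comm (u := y) (v := s)
  have := G.dist_comm (u := y) (v := z)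
  have := G.dist_comm (u := r) (v := z)
  omega

lemma exists_adj_half (hG : IsCCC G) {h : Set V} (hh : IsHalfspace G h) {p : V} (hp : p ∉ h) :
    ∃ a, G.Adj p a ∧ h ⊆ edgeHalf G p a := by
  obtain ⟨w, hw, hmin⟩ : ∃ w ∈ h, ∀ y ∈ h, G.dist p w ≤ G.dist p y := by
    have := Function.argminOn_mem (fun y => G.dist p y) h (half_nonempty hG hh)
    exact ⟨_, this, fun y hy => Function.argminOn_le (fun y => G.dist p y) h hy⟩
  have hne : w ≠ p := by rintro rfl; exact hp hw
  obtain ⟨a, ha, hd⟩ := exists_step hG hne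
  refine ⟨a, ha, fun y hy => ?_⟩
  obtain ⟨m, m1, m2, m3⟩ := ccc_med hG p w y
  have hm : m ∈ h := half_convex hG hh hw hy m2
  have := hmin m hm
  have hmw : m = w := (ccc_conn hG).dist_eq_zero_iff.1 (by omega)
  subst hmw
  have := (ccc_conn hG).dist_triangle (u := y) (v := m) (w := a)
  simp only [edgeHalf, mem_ofPred_eq]
  omega

/-- non-square edges give disjoint halfspaces -/
lemma disj_of_not_square (hG : IsCCC G) {v a b : V} (ha : G.Adj v a) (hb : G.Adj v b)
    (hab : b ≠ a) (hs : ¬ SpansSquare G v a b) : edgeHalf G v a ∩ edgeHalf G v b = ∅ := by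
  by_contra hne
  obtain ⟨z, hz1, hz2⟩ := nonempty_iff_ne_empty.2 hne
  simp only [edgeHalf, mem_ofPred_eq] at hz1 hz2
  have := ccc_adj_tri hG ha z
  have := ccc_adj_tri hG hb z
  obtain ⟨w, w1, w2, w3⟩ := ccc_quad hG (z := z) ha hb hab.symm (by omega) (by omega)
  exact hs ⟨w, by rintro rfl; omega, w1, w2⟩

lemma sep_finite (hG : IsCCC G) (p q : V) : {h | IsHalfspace G h ∧ p ∈ h ∧ q ∉ h}.Finite := by
  obtain ⟨n, hn⟩ : ∃ n, G.dist p q = n := ⟨_, rfl⟩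
  induction n generalizing q with
  | zero =>
    have : p = q := (ccc_conn hG).dist_eq_zero_iff.1 hn
    subst this
    convert Set.finite_empty
    ext h; simp
  | succ n ih =>
    have hne : p ≠ q := by rintro rfl; simp at hn
    obtain ⟨q', hq', hd⟩ := exists_step hG hne
    refine ((ih q' (by omega)).union (Set.finite_singleton (edgeHalf G q q'))).subset ?_
    rintro h ⟨hh, h1, h2⟩
    by_cases hm : q' ∈ h
    · right; exact half_eq hG hh hq' h2 hm
    · left; exact ⟨hh, h1, hm⟩

end graph
end CCCR
namespace CCCR
section ultra
variable {V : Type*} {G : SimpleGraph V}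

lemma ultra_up {σ : Set (Set V)} (hσ : IsUltra G σ) {h k : Set V} (hh : h ∈ σ)
    (hk : IsHalfspace G k) (hs : h ⊆ k) : k ∈ σ := by
  rw [hσ.2.1 k hk]
  intro hc
  obtain ⟨z, z1, z2⟩ := hσ.2.2 h hh _ hc
  exact z2 (hs z1)

lemma ultra_compl {σ : Set (Set V)} (hσ : IsUltra G σ) {h : Set V} (hh : IsHalfspace G h)
    (hn : h ∉ σ) : hᶜ ∈ σ := by
  by_contra hc
  exact hn ((hσ.2.1 h hh).2 hc)

lemma ultra_disj {σ : Set (Set V)} (hσ : IsUltra G σ) {h k : Set V} (hh : h ∈ σ) (hk : k ∈ σ)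
    (hd : h ∩ k = ∅) : False := by
  obtain ⟨z, hz⟩ := hσ.2.2 h hh k hk
  rw [hd] at hz; exact hz

lemma princ_ultra (hG : IsCCC G) (v : V) : IsUltra G (princ G v) := by
  refine ⟨fun h hh => hh.1, fun h hh => ?_, fun h hh k hk => ⟨v, hh.2, hk.2⟩⟩
  have := half_compl hG hh
  simp [princ, hh, this]

lemma med_ultra {x y z : Set (Set V)} (hx : IsUltra G x) (hy : IsUltra G y) (hz : IsUltra G z) :
    IsUltra G (med x y z) := by
  refine ⟨?_, ?_, ?_⟩
  · rintro h ((⟨h1, -⟩ | ⟨h1, -⟩) | ⟨h1, -⟩)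
    exacts [hx.1 h h1, hy.1 h h1, hz.1 h h1]
  · intro h hh
    have e1 := hx.2.1 h hh
    have e2 := hy.2.1 h hh
    have e3 := hz.2.1 h hh
    simp only [med, mem_union, mem_inter_iff]
    tauto
  · rintro h ((⟨h1, h2⟩ | ⟨h1, h2⟩) | ⟨h1, h2⟩) k ((⟨k1, k2⟩ | ⟨k1, k2⟩) | ⟨k1, k2⟩)
    · exact hx.2.2 h h1 k k1
    · exact hy.2.2 h h2 k k1
    · exact hx.2.2 h h1 k k2
    · exact hy.2.2 h h1 k k2
    · exact hy.2.2 h h1 k k1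
    · exact hz.2.2 h h2 k k1
    · exact hx.2.2 h h2 k k1
    · exact hz.2.2 h h1 k k2
    · exact hz.2.2 h h1 k k1

lemma ultra_princ_aux (hG : IsCCC G) {σ : Set (Set V)} (hσ : IsUltra G σ) (n : ℕ) : ∀ (p : V),
    {h | h ∈ σ ∧ p ∉ h}.Finite → {h | h ∈ σ ∧ p ∉ h}.ncard = n → ∃ v, σ = princ G v := by
  induction n using Nat.strong_induction_on with
  | _ n ih =>
    intro p hf hn
    by_cases he : ∀ h ∈ σ, p ∈ h
    · refine ⟨p, Subset.antisymm (fun h hh => ⟨hσ.1 h hh, he h hh⟩) ?_⟩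
      rintro h ⟨hh, hp⟩
      by_contra hc
      exact he _ (ultra_compl hσ hh hc) hp
    · push Not at he
      obtain ⟨h, hh, hp⟩ := he
      obtain ⟨a, ha, hs⟩ := exists_adj_half hG (hσ.1 h hh) hp
      have hj : edgeHalf G p a ∈ σ := ultra_up hσ hh (isHalf_edge ha) hs
      have hss : {h | h ∈ σ ∧ a ∉ h} ⊂ {h | h ∈ σ ∧ p ∉ h} := by
        refine ⟨?_, fun hc => ?_⟩
        · rintro k ⟨k1, k2⟩
          refine ⟨k1, fun hpk => ?_⟩
          have e := half_eq hG (hσ.1 k k1) ha.symm k2 hpk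
          rw [← edgeHalf_compl hG ha] at e
          exact (hσ.2.1 _ (isHalf_edge ha)).1 hj (e ▸ k1)
        · exact (hc ⟨hj, not_mem_edgeHalf_left⟩).2 (mem_edgeHalf_right hG ha)
      exact ih _ (hn ▸ Set.ncard_lt_ncard hss hf) a (hf.subset hss.1) rfl

lemma ultra_princ (hG : IsCCC G) {σ : Set (Set V)} (hσ : IsUltra G σ) {p : V}
    (hf : {h | h ∈ σ ∧ p ∉ h}.Finite) : ∃ v, σ = princ G v :=
  ultra_princ_aux hG hσ _ p hf rfl

lemma grom_top_iff {p : V} {x y : Set (Set V)} :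
    grom G p x y = ⊤ ↔ {h : Set V | h ∈ x ∧ h ∈ y ∧ p ∉ h}.Infinite := by
  simp [grom, Set.encard_eq_top_iff]

lemma grom_zero_iff {p : V} {x y : Set (Set V)} :
    grom G p x y = 0 ↔ ∀ h, h ∈ x → h ∈ y → p ∈ h := by
  simp only [grom, Set.encard_eq_zero, Set.eq_empty_iff_forall_notMem, mem_ofPred_eq]
  constructor
  · intro H h h1 h2
    by_contra hp
    exact H h ⟨h1, h2, hp⟩
  · rintro H h ⟨h1, h2, hp⟩
    exact hp (H h h1 h2)

lemma grom_comm (p : V) (x y : Set (Set V)) : grom G p x y = grom G p y x := by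
  unfold grom; congr 1; ext h; simp only [mem_ofPred_eq]; tauto

lemma grom_top_base (hG : IsCCC G) {x y : Set (Set V)} (hx : IsUltra G x) (p q : V)
    (h : grom G p x y = ⊤) : grom G q x y = ⊤ := by
  rw [grom_top_iff] at *
  intro hf
  refine h ((hf.union (sep_finite hG q p)).subset ?_)
  rintro k ⟨k1, k2, k3⟩
  by_cases hq : q ∈ k
  · right; exact ⟨hx.1 k k1, hq, k3⟩
  · left; exact ⟨k1, k2, hq⟩

lemma bdry_of_inf (hG : IsCCC G) {x y : Set (Set V)} (hx : IsUltra G x) (p : V)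
    (h : grom G p x y = ⊤) : IsBdryPt G x := by
  refine ⟨hx, ?_⟩
  rintro v rfl
  rw [grom_top_iff] at h
  exact h ((sep_finite hG v p).subset (fun k hk => ⟨hk.1.1, hk.1.2, hk.2.2⟩))

lemma bdry_self (hG : IsCCC G) {x : Set (Set V)} (hx : IsBdryPt G x) (p : V) :
    grom G p x x = ⊤ := by
  rw [grom_top_iff]
  intro hf
  obtain ⟨v, hv⟩ := ultra_princ hG hx.1 (p := p) (hf.subset fun h hh => ⟨hh.1, hh.1, hh.2⟩)
  exact hx.2 v hv

/-- The straight ray point produced by absence of extremal vertices. -/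
lemma exists_straight (hG : IsCCC G) (hne : NoExtremal G) {p a : V} (ha : G.Adj p a) :
    ∃ (e : V) (d : Bdry G), G.Adj p e ∧ edgeHalf G p a ∩ edgeHalf G p e = ∅ ∧
      (∀ h ∈ d.1, p ∉ h → h ⊆ edgeHalf G p e) ∧
      (∀ h ∈ d.1, p ∉ h → ∀ k ∈ d.1, p ∉ k → h ⊆ k ∨ k ⊆ h) := by
  have step : ∀ v a : V, ∃ b, G.Adj v a → G.Adj v b ∧ b ≠ a ∧ ¬ SpansSquare G v a b := by
    intro v a
    by_cases h : G.Adj v a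
    · have := hne v
      unfold Extremal at this
      push Not at this
      obtain ⟨b, hb⟩ := this a h
      exact ⟨b, fun _ => hb⟩
    · exact ⟨a, fun h' => absurd h' h⟩
  choose nx hnx using step
  let s : ℕ → V × V := fun n => Nat.rec (a, p) (fun _ q => (q.2, nx q.2 q.1)) n
  let r : ℕ → V := fun n => (s n).2
  have s0 : s 0 = (a, p) := rfl
  have sS : ∀ n, s (n + 1) = ((s n).2, nx (s n).2 (s n).1) := fun n => rfl
  have hadj : ∀ n, G.Adj (s n).2 (s n).1 := by
    intro n
    induction n with
    | zero => exact ha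
    | succ n ih => rw [sS]; exact (hnx _ _ ih).1.symm
  have hr : ∀ n, G.Adj (r n) (r (n + 1)) := fun n => (hnx _ _ (hadj n)).1
  let k : ℕ → Set V := fun n => edgeHalf G (r n) (r (n + 1))
  have hdis : ∀ n, edgeHalf G (s n).2 (s n).1 ∩ k n = ∅ := fun n =>
    disj_of_not_square hG (hadj n) (hr n) (hnx _ _ (hadj n)).2.1 (hnx _ _ (hadj n)).2.2
  have hsub : ∀ n, k (n + 1) ⊆ k n := by
    intro n z hz
    by_contra hc
    have h1 : z ∈ edgeHalf G (r (n + 1)) (r n) := by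
      rw [← edgeHalf_compl hG (hr n)]; exact hc
    exact (Set.eq_empty_iff_forall_notMem.1 (hdis (n + 1)) z) ⟨h1, hz⟩
  have hanti : Antitone k := antitone_nat_of_succ_le hsub
  have hin : ∀ m n, m < n → r n ∈ k m := by
    intro m n hmn
    obtain ⟨n, rfl⟩ : ∃ n', n = n' + 1 := ⟨n - 1, by omega⟩
    exact hanti (Nat.lt_succ_iff.1 hmn) (mem_edgeHalf_right hG (hr n))
  have hout : ∀ m n, n ≤ m → r n ∉ k m := by
    intro m n hmn hc
    exact not_mem_edgeHalf_left (hanti hmn hc)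
  have hkh : ∀ n, IsHalfspace G (k n) := fun n => isHalf_edge (hr n)
  -- crossing
  have hcross : ∀ h, IsHalfspace G h → ∀ n, r n ∉ h → r (n+1) ∈ h → h = k n :=
    fun h hh n h1 h2 => half_eq hG hh (hr n) h1 h2
  have hcross' : ∀ h, IsHalfspace G h → ∀ n, r n ∈ h → r (n+1) ∉ h → h = (k n)ᶜ := by
    intro h hh n h1 h2
    rw [edgeHalf_compl hG (hr n)]
    exact half_eq hG hh (hr n).symm h2 h1
  have hfind : ∀ h : Set V, ∀ n, r 0 ∉ h → r n ∈ h → ∃ m, r m ∉ h ∧ r (m+1) ∈ h := by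
    intro h n h0 hn
    induction n with
    | zero => exact absurd hn h0
    | succ n ih =>
      by_cases hc : r n ∈ h
      · exact ih hc
      · exact ⟨n, hc, hn⟩
  have hmemk : ∀ n, k n ∈ rayEnd G r := fun n => ⟨hkh n, n + 1, fun m hm => hin n m (by omega)⟩
  have hchar : ∀ h ∈ rayEnd G r, r 0 ∉ h → ∃ n, h = k n := by
    rintro h ⟨hh, N, hN⟩ h0
    obtain ⟨m, m1, m2⟩ := hfind h N h0 (hN N le_rfl)
    exact ⟨m, hcross h hh m m1 m2⟩
  have hdich : ∀ h, IsHalfspace G h → r 0 ∉ h → h ∉ rayEnd G r → ∀ n, r n ∉ h := by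
    intro h hh h0 hn n hc
    obtain ⟨m, m1, m2⟩ := hfind h n h0 hc
    have := hcross h hh m m1 m2
    exact hn (this ▸ hmemk m)
  have hult : IsUltra G (rayEnd G r) := by
    refine ⟨fun h hh => hh.1, fun h hh => ⟨?_, ?_⟩, ?_⟩
    · rintro ⟨-, N, hN⟩ ⟨-, M, hM⟩
      exact hM (max N M) (le_max_right _ _) (hN _ (le_max_left _ _))
    · intro hc
      by_cases h0 : r 0 ∈ h
      · have := hdich hᶜ (half_compl hG hh) (by simpa using h0) hc
        exact ⟨hh, 0, fun n _ => by simpa using this n⟩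
      · by_contra hc'
        have := hdich h hh h0 hc'
        exact hc ⟨half_compl hG hh, 0, fun n _ => this n⟩
    · rintro h ⟨-, N, hN⟩ h' ⟨-, M, hM⟩
      exact ⟨r (max N M), hN _ (le_max_left _ _), hM _ (le_max_right _ _)⟩
  have hkinj : Function.Injective k := by
    intro m n hmn
    by_contra hne'
    rcases lt_or_gt_of_ne hne' with h | h
    · exact hout n n le_rfl (hmn ▸ hin m n h)
    · exact hout m m le_rfl (hmn ▸ hin n m h)
  have hbd : IsBdryPt G (rayEnd G r) := by
    refine bdry_of_inf hG (y := rayEnd G r) hult p ?_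
    rw [grom_top_iff]
    refine (Set.infinite_range_of_injective hkinj).mono ?_
    rintro _ ⟨n, rfl⟩
    exact ⟨hmemk n, hmemk n, hout n 0 (Nat.zero_le _)⟩
  refine ⟨r 1, ⟨rayEnd G r, hbd⟩, hr 0, hdis 0, ?_, ?_⟩
  · intro h hh hp
    obtain ⟨n, rfl⟩ := hchar h hh hp
    exact hanti (Nat.zero_le n)
  · intro h hh hp h' hh' hp'
    obtain ⟨n, rfl⟩ := hchar h hh hp
    obtain ⟨m, rfl⟩ := hchar h' hh' hp'
    rcases le_total n m with h | h
    · right; exact hanti h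
    · left; exact hanti h

/-- points at infinite distance along the same straight ray -/
lemma straight_top (hG : IsCCC G) {d y z : Set (Set V)} (hy : IsUltra G y)
    {p : V} (hch : ∀ h ∈ d, p ∉ h → ∀ k ∈ d, p ∉ k → h ⊆ k ∨ k ⊆ h)
    (h1 : grom G p y d = ⊤) (h2 : grom G p z d = ⊤) (hz : IsUltra G z) : grom G p y z = ⊤ := by
  rw [grom_top_iff] at *
  refine h2.mono ?_
  rintro h ⟨a1, a2, a3⟩
  refine ⟨?_, a1, a3⟩
  by_contra hc
  obtain ⟨q, hq⟩ := half_nonempty hG (hz.1 h a1)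
  refine h1 ((sep_finite hG q p).subset ?_)
  rintro t ⟨t1, t2, t3⟩
  refine ⟨hy.1 t t1, ?_, t3⟩
  rcases hch h a2 a3 t t2 t3 with h' | h'
  · exact h' hq
  · exact absurd (ultra_up hy t1 (hz.1 h a1) h') hc

lemma op_disj (hG : IsCCC G) {x y z : Set (Set V)} (hx : IsUltra G x) (hy : IsUltra G y)
    (hop : Op G x y z) {p : V} (hp : med x y z = princ G p) {h k : Set V} (hh : h ∈ x)
    (hph : p ∉ h) (hk : k ∈ y) (hpk : p ∉ k) {u : Set (Set V)} (hu : IsUltra G u)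
    (h1 : h ∈ u) (h2 : k ∈ u) : False := by
  have hxy : ∀ j, j ∈ x → j ∈ y → p ∈ j := fun j a b =>
    ((hp ▸ (Or.inl (Or.inl ⟨a, b⟩)) : j ∈ princ G p)).2
  have hkx : kᶜ ∈ x := ultra_compl hx (hy.1 k hk) (fun hc => hpk (hxy k hc hk))
  have hhy : hᶜ ∈ y := ultra_compl hy (hx.1 h hh) (fun hc => hph (hxy h hh hc))
  have hkp : kᶜ ∈ princ G p := ⟨half_compl hG (hy.1 k hk), hpk⟩
  have hhp : hᶜ ∈ princ G p := ⟨half_compl hG (hx.1 h hh), hph⟩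
  have hM := med_ultra hx hy hu
  have mem : med x y u ∈ rInterval G x y := ⟨hM, fun j hj => Or.inl (Or.inl hj)⟩
  have hhM : h ∈ med x y u := Or.inr ⟨h1, hh⟩
  have hkM : k ∈ med x y u := Or.inl (Or.inr ⟨hk, h2⟩)
  rw [hop.2, hp] at mem
  rcases mem with ⟨-, hm⟩ | ⟨-, hm⟩
  · exact ultra_disj hM hkM (hm ⟨hkx, hkp⟩) (by simp)
  · exact ultra_disj hM hhM (hm ⟨hhp, hhy⟩) (by simp)

end ultra
end CCCR
namespace CCCR
section rel

lemma toE_top : toE ⊤ = ⊤ := by simp [toE]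

lemma toE_nat (n : ℕ) : toE (n : ℕ∞) = ((n : ℝ) : EReal) := by
  simp [toE]
  rfl

lemma toE_nat_add (a b : ℕ) : toE ((a : ℕ∞) + b) = (((a : ℝ) + b : ℝ) : EReal) := by
  rw [← Nat.cast_add, toE_nat, Nat.cast_add]

lemma toE_comb (a b c d : ℕ∞) :
    toE a + toE b - toE c - toE d = toE (a + b) - toE (c + d) := by
  induction a using ENat.recTopCoe <;> induction b using ENat.recTopCoe <;>
  induction c using ENat.recTopCoe <;> induction d using ENat.recTopCoe <;>
  simp only [top_add, add_top, toE_top, toE_nat, toE_nat_add, ← EReal.coe_add,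
    ← EReal.coe_sub, EReal.top_sub_coe, EReal.top_add_coe, EReal.coe_add_top,
    EReal.top_add_top, EReal.bot_sub, EReal.sub_top, sub_sub]

lemma toE_tn (n : ℕ) : toE ⊤ - toE n = ⊤ := by rw [toE_top, toE_nat, EReal.top_sub_coe]
lemma toE_nt (n : ℕ∞) : toE n - toE ⊤ = ⊥ := by rw [toE_top, EReal.sub_top]
lemma toE_nn (n m : ℕ) : toE n - toE m = (((n : ℝ) - m : ℝ) : EReal) := by
  rw [toE_nat, toE_nat, EReal.coe_sub]

lemma toE_rel {B C B' C' : ℕ∞} (h : B ≠ ⊤ ∨ C ≠ ⊤) (h' : B' ≠ ⊤ ∨ C' ≠ ⊤)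
    (he : toE B' - toE C' = toE B - toE C) : B + C' = B' + C := by
  induction B using ENat.recTopCoe with
  | top =>
    have hC : C ≠ ⊤ := by tauto
    lift C to ℕ using hC
    rw [toE_tn] at he
    induction C' using ENat.recTopCoe with
    | top => rw [toE_nt] at he; simp at he
    | coe d =>
      induction B' using ENat.recTopCoe with
      | top => simp
      | coe b => rw [toE_nn] at he; exact absurd he (EReal.coe_ne_top _)
  | coe a =>
    induction C using ENat.recTopCoe with
    | top =>
      rw [toE_nt] at he
      induction C' using ENat.recTopCoe with
      | top => simp
      | coe d =>
        induction B' using ENat.recTopCoe with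
        | top => rw [toE_tn] at he; simp at he
        | coe b => rw [toE_nn] at he; exact absurd he (EReal.coe_ne_bot _)
    | coe c =>
      rw [toE_nn] at he
      induction C' using ENat.recTopCoe with
      | top => rw [toE_nt] at he; exact absurd he.symm (EReal.coe_ne_bot _)
      | coe d =>
        induction B' using ENat.recTopCoe with
        | top => rw [toE_tn] at he; exact absurd he.symm (EReal.coe_ne_top _)
        | coe b =>
          rw [toE_nn] at he
          have h2 : ((b : ℝ) - d) = a - c := by exact_mod_cast EReal.coe_injective he
          have h3 : ((a + d : ℕ) : ℝ) = ((b + c : ℕ) : ℝ) := by push_cast; linarith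
          exact_mod_cast h3

variable {V V' : Type*} {G : SimpleGraph V} {G' : SimpleGraph V'}

lemma inA_base (hG : IsCCC G) {x y z w : Set (Set V)} (hx : IsUltra G x) (hy : IsUltra G y)
    (hz : IsUltra G z) {p : V} (h : inA G p x y z w) : memA G x y z w := by
  intro q
  have key : ∀ {a b : Set (Set V)}, IsUltra G a → grom G p a b ≠ ⊤ → grom G q a b ≠ ⊤ :=
    fun ha h1 h2 => h1 (grom_top_base hG ha q p h2)
  simp only [inA, tripod, ne_eq, ENat.add_eq_top, not_or] at h ⊢
  have k1 := key (b := y) hx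
  have k2 := key (b := z) hx
  have k3 := key (b := w) hx
  have k4 := key (b := z) hy
  have k5 := key (b := w) hy
  have k6 := key (b := w) hz
  simp only [ne_eq] at k1 k2 k3 k4 k5 k6
  tauto

/-- two triples agreeing up to an additive constant -/
def TRel (A B C A' B' C' : ℕ∞) : Prop :=
  ∃ n m : ℕ, A + n = A' + m ∧ B + n = B' + m ∧ C + n = C' + m

lemma TRel_of {A B C A' B' C' : ℕ∞}
    (h : (A ≠ ⊤ ∧ B ≠ ⊤) ∨ (A ≠ ⊤ ∧ C ≠ ⊤) ∨ (B ≠ ⊤ ∧ C ≠ ⊤))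
    (h' : (A' ≠ ⊤ ∧ B' ≠ ⊤) ∨ (A' ≠ ⊤ ∧ C' ≠ ⊤) ∨ (B' ≠ ⊤ ∧ C' ≠ ⊤))
    (h1 : A + B' = A' + B) (h2 : A + C' = A' + C) (h3 : B + C' = B' + C) :
    TRel A B C A' B' C' := by
  by_cases hA : A = ⊤
  · have hB : B ≠ ⊤ := by tauto
    have hC : C ≠ ⊤ := by tauto
    have hB' : B' ≠ ⊤ := by
      rintro rfl
      have : C' ≠ ⊤ := by tauto
      lift B to ℕ using hB
      lift C to ℕ using hC
      lift C' to ℕ using this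
      rw [top_add] at h3
      exact absurd h3 (by exact_mod_cast ENat.natCast_ne_top _)
    lift B to ℕ using hB
    lift B' to ℕ using hB'
    exact ⟨B', B, h1, add_comm _ _, by rw [add_comm C, add_comm C', h3]⟩
  · have hA' : A' ≠ ⊤ := by
      rintro rfl
      have b' : B' ≠ ⊤ := by tauto
      rw [top_add, ENat.add_eq_top] at h1
      tauto
    lift A to ℕ using hA
    lift A' to ℕ using hA'
    exact ⟨A', A, add_comm _ _, by rw [add_comm B, add_comm B', h1],
      by rw [add_comm C, add_comm C', h2]⟩

lemma mob_rel (hG : IsCCC G) {f : Bdry G → Bdry G'} (hmob : Mobius G G' f)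
    (x y z w : Bdry G) (p : V) (p' : V') {A B C A' B' C' : ℕ∞}
    (eA : A = grom G p x.1 y.1 + grom G p z.1 w.1)
    (eB : B = grom G p x.1 z.1 + grom G p y.1 w.1)
    (eC : C = grom G p x.1 w.1 + grom G p y.1 z.1)
    (eA' : A' = grom G' p' (f x).1 (f y).1 + grom G' p' (f z).1 (f w).1)
    (eB' : B' = grom G' p' (f x).1 (f z).1 + grom G' p' (f y).1 (f w).1)
    (eC' : C' = grom G' p' (f x).1 (f w).1 + grom G' p' (f y).1 (f z).1)
    (h : (A ≠ ⊤ ∧ B ≠ ⊤) ∨ (A ≠ ⊤ ∧ C ≠ ⊤) ∨ (B ≠ ⊤ ∧ C ≠ ⊤)) :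
    TRel A B C A' B' C' := by
  have m1 : memA G x.1 y.1 z.1 w.1 := by
    refine inA_base hG x.2.1 y.2.1 z.2.1 (p := p) ?_
    simp only [inA, tripod]
    rw [← eA, ← eB, ← eC]; exact h
  have m2 : memA G x.1 z.1 y.1 w.1 := by
    refine inA_base hG x.2.1 z.2.1 y.2.1 (p := p) ?_
    simp only [inA, tripod]
    rw [grom_comm p z.1 y.1, ← eA, ← eB, ← eC]; tauto
  have m3 : memA G x.1 w.1 y.1 z.1 := by
    refine inA_base hG x.2.1 w.2.1 y.2.1 (p := p) ?_
    simp only [inA, tripod]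
    rw [grom_comm p w.1 y.1, grom_comm p w.1 z.1, ← eA, ← eB, ← eC]; tauto
  obtain ⟨a1, c1⟩ := hmob x y z w m1
  obtain ⟨-, c2⟩ := hmob x z y w m2
  obtain ⟨-, c3⟩ := hmob x w y z m3
  have h' := a1 p'
  have c1 := c1 p p'
  have c2 := c2 p p'
  have c3 := c3 p p'
  simp only [inA, tripod] at h'
  rw [← eA', ← eB', ← eC'] at h'
  simp only [crv, toE_comb] at c1 c2 c3
  rw [← eB, ← eC, ← eB', ← eC'] at c1
  rw [grom_comm p z.1 y.1, grom_comm p' (f z).1 (f y).1, ← eA, ← eC, ← eA', ← eC'] at c2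
  rw [grom_comm p w.1 y.1, grom_comm p w.1 z.1, grom_comm p' (f w).1 (f y).1,
    grom_comm p' (f w).1 (f z).1, ← eA, ← eB, ← eA', ← eB'] at c3
  exact TRel_of h h' (toE_rel (by tauto) (by tauto) c3) (toE_rel (by tauto) (by tauto) c2)
    (toE_rel (by tauto) (by tauto) c1)

lemma TRel.top1 {A B C A' B' C' : ℕ∞} (h : TRel A B C A' B' C') (hA : A = ⊤) : A' = ⊤ := by
  obtain ⟨n, m, h1, -, -⟩ := h
  subst hA
  rw [top_add] at h1
  have := ENat.add_eq_top.1 h1.symm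
  simpa using this

/-- finiteness is preserved -/
lemma mob_fin (hG : IsCCC G) {f : Bdry G → Bdry G'} (hmob : Mobius G G' f)
    (a b c : Bdry G) (p : V) (p' : V') (h1 : grom G p a.1 c.1 ≠ ⊤) (h2 : grom G p b.1 c.1 ≠ ⊤) :
    grom G' p' (f a).1 (f c).1 ≠ ⊤ := by
  have hB : grom G p c.1 a.1 + grom G p c.1 b.1 ≠ ⊤ := by
    rw [grom_comm p c.1 a.1, grom_comm p c.1 b.1]
    simp [h1, h2]
  have hC : grom G p c.1 b.1 + grom G p c.1 a.1 ≠ ⊤ := by rwa [add_comm]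
  obtain ⟨n, m, -, e, -⟩ := mob_rel hG hmob c c a b p p' rfl rfl rfl rfl rfl rfl
    (Or.inr (Or.inr ⟨hB, hC⟩))
  intro hc
  rw [grom_comm p' (f c).1 (f a).1, hc, top_add, top_add, ENat.add_eq_top] at e
  simp [hB] at e

end rel
end CCCR
namespace CCCR
section main
variable {V V' : Type*} {G : SimpleGraph V} {G' : SimpleGraph V'}

structure Cfg0 (G : SimpleGraph V) (p : V) (x1 x2 x0 : Bdry G) : Prop where
  z12 : grom G p x1.1 x2.1 = 0
  z10 : grom G p x1.1 x0.1 = 0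
  z20 : grom G p x2.1 x0.1 = 0

/-- opposite configuration -/
structure Cfg (G : SimpleGraph V) (p : V) (x1 x2 x0 : Bdry G) : Prop extends
    Cfg0 G p x1 x2 x0 where
  op : ∀ h ∈ x1.1, p ∉ h → ∀ k ∈ x2.1, p ∉ k → ∀ u, IsUltra G u → h ∈ u → k ∈ u → False

lemma Cfg0.symm {p : V} {x1 x2 x0 : Bdry G} (c : Cfg0 G p x1 x2 x0) : Cfg0 G p x2 x1 x0 :=
  ⟨by rw [grom_comm]; exact c.z12, c.z20, c.z10⟩

lemma Cfg.symm {p : V} {x1 x2 x0 : Bdry G} (c : Cfg G p x1 x2 x0) : Cfg G p x2 x1 x0 :=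
  ⟨c.toCfg0.symm, fun h hh hp k hk hpk u hu h1 h2 => c.op k hk hpk h hh hp u hu h2 h1⟩

lemma cfg0_of_med {p : V} {x1 x2 x0 : Bdry G} (h : med x1.1 x2.1 x0.1 = princ G p) :
    Cfg0 G p x1 x2 x0 := by
  refine ⟨?_, ?_, ?_⟩ <;> rw [grom_zero_iff] <;> intro k h1 h2
  · exact ((h ▸ (Or.inl (Or.inl ⟨h1, h2⟩)) : k ∈ princ G p)).2
  · exact ((h ▸ (Or.inr ⟨h2, h1⟩) : k ∈ princ G p)).2
  · exact ((h ▸ (Or.inl (Or.inr ⟨h1, h2⟩)) : k ∈ princ G p)).2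

lemma Cfg.zero {p : V} {x1 x2 x0 : Bdry G} (c : Cfg G p x1 x2 x0) (u : Bdry G) :
    grom G p x1.1 u.1 = 0 ∨ grom G p x2.1 u.1 = 0 := by
  by_contra hc
  push Not at hc
  obtain ⟨h1, h2⟩ := hc
  rw [Ne, grom_zero_iff] at h1 h2
  push Not at h1 h2
  obtain ⟨h, a1, a2, a3⟩ := h1
  obtain ⟨k, b1, b2, b3⟩ := h2
  exact c.op h a1 a3 k b1 b3 u.1 u.2.1 a2 b2

lemma enat_cancel_r {a b m : ℕ∞} (hm : m ≠ ⊤) : a + m = b + m ↔ a = b :=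
  (ENat.add_left_injective_of_ne_top hm).eq_iff

lemma enat_cancel_l {a b m : ℕ∞} (hm : m ≠ ⊤) : m + a = m + b ↔ a = b :=
  (ENat.add_right_injective_of_ne_top hm).eq_iff

/-- at most one of three is infinite -/
def AtMost1 (a b c : ℕ∞) : Prop := (a ≠ ⊤ ∧ b ≠ ⊤) ∨ (a ≠ ⊤ ∧ c ≠ ⊤) ∨ (b ≠ ⊤ ∧ c ≠ ⊤)

lemma defect (hG : IsCCC G) {f : Bdry G → Bdry G'} (hmob : Mobius G G' f) {p : V} {p' : V'}
    {x1 x2 x0 : Bdry G} (c : Cfg G p x1 x2 x0) (c' : Cfg0 G' p' (f x1) (f x2) (f x0)) (u : Bdry G)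
    (hu : AtMost1 (grom G p x0.1 u.1) (grom G p x2.1 u.1) (grom G p x1.1 u.1)) :
    ∃ n : ℕ, grom G' p' (f x0).1 (f u).1 = grom G p x0.1 u.1 + n ∧
      grom G' p' (f x1).1 (f u).1 = grom G p x1.1 u.1 + n ∧
      grom G' p' (f x2).1 (f u).1 = grom G p x2.1 u.1 + n := by
  obtain ⟨n, m, e0, e2, e1⟩ := mob_rel hG hmob x1 x2 x0 u p p'
    (A := grom G p x0.1 u.1) (B := grom G p x2.1 u.1) (C := grom G p x1.1 u.1)
    (A' := grom G' p' (f x0).1 (f u).1) (B' := grom G' p' (f x2).1 (f u).1)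
    (C' := grom G' p' (f x1).1 (f u).1)
    (by rw [c.z12, zero_add]) (by rw [c.z10, zero_add]) (by rw [c.z20, add_zero])
    (by rw [c'.z12, zero_add]) (by rw [c'.z10, zero_add]) (by rw [c'.z20, add_zero]) hu
  have hmn : m ≤ n := by
    rcases c.zero u with h | h
    · rw [h, zero_add] at e1
      have : (m : ℕ∞) ≤ n := e1 ▸ le_add_self
      exact_mod_cast this
    · rw [h, zero_add] at e2
      have : (m : ℕ∞) ≤ n := e2 ▸ le_add_self
      exact_mod_cast this
  obtain ⟨k, rfl⟩ := Nat.exists_eq_add_of_le' hmn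
  have hm : (m : ℕ∞) ≠ ⊤ := ENat.natCast_ne_top m
  push_cast at e0 e1 e2
  rw [← add_assoc] at e0 e1 e2
  exact ⟨k, ((enat_cancel_r hm).1 e0).symm,
    ((enat_cancel_r hm).1 e1).symm, ((enat_cancel_r hm).1 e2).symm⟩

lemma grom_zero_of_straight {d y : Set (Set V)} {p a e : V} (hy : IsUltra G y)
    (hd : edgeHalf G p a ∩ edgeHalf G p e = ∅) (hsub : ∀ h ∈ d, p ∉ h → h ⊆ edgeHalf G p e)
    (hj : edgeHalf G p a ∈ y) : grom G p y d = 0 := by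
  rw [grom_zero_iff]
  intro h h1 h2
  by_contra hp
  refine ultra_disj hy hj h1 ?_
  ext z
  simp only [mem_inter_iff, mem_empty_iff_false, iff_false, not_and]
  intro z1 z2
  have : z ∈ edgeHalf G p a ∩ edgeHalf G p e := ⟨z1, hsub h h2 hp z2⟩
  rw [hd] at this; exact this

lemma exists_common_adj (hG : IsCCC G) {x y : Set (Set V)} (hx : IsUltra G x) (hy : IsUltra G y)
    {p : V} (h : grom G p x y ≠ 0) :
    ∃ a, G.Adj p a ∧ edgeHalf G p a ∈ x ∧ edgeHalf G p a ∈ y := by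
  rw [Ne, grom_zero_iff] at h
  push Not at h
  obtain ⟨k, k1, k2, k3⟩ := h
  obtain ⟨a, ha, hs⟩ := exists_adj_half hG (hx.1 k k1) k3
  exact ⟨a, ha, ultra_up hx k1 (isHalf_edge ha) hs, ultra_up hy k2 (isHalf_edge ha) hs⟩

lemma exists_witness (hG : IsCCC G) (hne : NoExtremal G) {p : V} {x1 x2 x0 : Bdry G}
    (c : Cfg G p x1 x2 x0) (v : Bdry G) (h0 : grom G p x0.1 v.1 = ⊤)
    (h1 : grom G p x1.1 v.1 = ⊤) :
    ∃ d : Bdry G, grom G p x0.1 d.1 ≠ ⊤ ∧ grom G p v.1 d.1 ≠ ⊤ ∧ grom G p x2.1 d.1 ≠ ⊤ := by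
  obtain ⟨q, hq, j1, -⟩ := exists_common_adj hG x1.2.1 v.2.1 (p := p) (by rw [h1]; simp)
  have h0q : grom G q x0.1 v.1 = ⊤ := grom_top_base hG x0.2.1 p q h0
  obtain ⟨b, hb, i0, iv⟩ := exists_common_adj hG x0.2.1 v.2.1 (p := q) (by rw [h0q]; simp)
  obtain ⟨e, d, he, hdis, hsub, -⟩ := exists_straight hG hne hb
  have g0 : grom G q x0.1 d.1 = 0 := grom_zero_of_straight x0.2.1 hdis hsub i0
  have gv : grom G q v.1 d.1 = 0 := grom_zero_of_straight v.2.1 hdis hsub iv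
  have g2 : grom G q x2.1 d.1 = 0 := by
    rw [grom_zero_iff]
    intro h a1 a2
    by_contra hqh
    have hk : edgeHalf G q e ∈ x2.1 := ultra_up x2.2.1 a1 (isHalf_edge he) (hsub h a2 hqh)
    have pj : p ∉ edgeHalf G p q := not_mem_edgeHalf_left
    have qj : q ∈ edgeHalf G p q := mem_edgeHalf_right hG hq
    have ek : e ∈ edgeHalf G q e := mem_edgeHalf_right hG he
    by_cases hpk : p ∈ edgeHalf G q e
    · have e1 := half_eq hG (isHalf_edge he) hq.symm not_mem_edgeHalf_left hpk
      rw [← edgeHalf_compl hG hq] at e1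
      have : (edgeHalf G p q)ᶜ ∈ x0.1 := ultra_compl x0.2.1 (isHalf_edge hq)
        (fun hc => pj (grom_zero_iff.1 c.z10 _ j1 hc))
      rw [e1] at hdis
      exact ultra_disj x0.2.1 i0 this hdis
    · have hej : e ∈ edgeHalf G p q := by
        by_contra hc
        have e1 := half_eq hG (isHalf_edge hq) he.symm hc qj
        rw [← edgeHalf_compl hG he] at e1
        rw [e1] at pj
        exact pj hpk
      exact c.op _ j1 pj _ hk hpk _ (princ_ultra hG e) ⟨isHalf_edge hq, hej⟩ ⟨isHalf_edge he, ek⟩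
  refine ⟨d, fun hc => ?_, fun hc => ?_, fun hc => ?_⟩
  · rw [grom_top_base hG x0.2.1 p q hc] at g0; simp at g0
  · rw [grom_top_base hG v.2.1 p q hc] at gv; simp at gv
  · rw [grom_top_base hG x2.2.1 p q hc] at g2; simp at g2

lemma bad_top (hG : IsCCC G) (hne : NoExtremal G)
    {f : Bdry G → Bdry G'} (hmob : Mobius G G' f) {p : V} {p' : V'}
    {x1 x2 x0 : Bdry G} (c : Cfg G p x1 x2 x0) (v : Bdry G)
    (h0 : grom G p x0.1 v.1 = ⊤) (h1 : grom G p x1.1 v.1 = ⊤) :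
    grom G' p' (f x0).1 (f v).1 = ⊤ := by
  obtain ⟨d, d0, dv, d2⟩ := exists_witness hG hne c v h0 h1
  have v2 : grom G p x2.1 v.1 = 0 := by
    rcases c.zero v with h | h
    · rw [h] at h1; simp at h1
    · exact h
  have r := mob_rel hG hmob v x0 x2 d p p' rfl rfl rfl rfl rfl rfl (Or.inr (Or.inr
    ⟨by rw [grom_comm p v.1, v2]; simpa using d0,
     by rw [grom_comm p x0.1, c.z20]; simpa using dv⟩))
  have t := r.top1 (by rw [grom_comm p v.1, h0, top_add])
  have fin := mob_fin hG hmob x2 x0 d p p' d2 d0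
  rw [ENat.add_eq_top, grom_comm] at t
  tauto

/-- a tuple in the domain yields a contradiction with a positive defect -/
lemma tuple_contra {γ a b a' b' : ℕ∞} {n : ℕ} (hn : n ≠ 0) (ea : a' = a + n) (eb : b' = b + n)
    (hf : a ≠ ⊤ ∨ b ≠ ⊤) (h : TRel γ a b 0 a' b') : False := by
  obtain ⟨s, t, h1, h2, h3⟩ := h
  subst ea eb
  have hst : s = n + t := by
    rcases hf with hf | hf
    · rw [add_assoc, enat_cancel_l hf] at h2
      exact_mod_cast h2
    · rw [add_assoc, enat_cancel_l hf] at h3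
      exact_mod_cast h3
  rw [zero_add] at h1
  have : (s : ℕ∞) ≤ t := h1 ▸ le_add_self
  have : s ≤ t := by exact_mod_cast this
  omega

lemma AtMost1.right {a b c : ℕ∞} (h : AtMost1 a b c) : b ≠ ⊤ ∨ c ≠ ⊤ := by
  unfold AtMost1 at h; tauto

lemma prop_cases {g a0 a1 a2 b : Prop}
    (hu : (¬a0 ∧ ¬a2) ∨ (¬a0 ∧ ¬a1) ∨ (¬a2 ∧ ¬a1))
    (T02 : ¬((¬g ∧ ¬a0) ∨ (¬g ∧ ¬a2) ∨ (¬a0 ∧ ¬a2)))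
    (T01 : ¬((¬g ∧ ¬(a0 ∨ b)) ∨ (¬g ∧ ¬a1) ∨ (¬(a0 ∨ b) ∧ ¬a1)))
    (T12 : ¬((¬g ∧ ¬a1) ∨ (¬g ∧ ¬(a2 ∨ b)) ∨ (¬a1 ∧ ¬(a2 ∨ b)))) :
    g ∧ b ∧ ((a2 ∧ ¬a0 ∧ ¬a1) ∨ (¬a2 ∧ a0 ∧ ¬a1)) := by
  by_cases g <;> by_cases a0 <;> by_cases a1 <;> by_cases a2 <;> by_cases b <;> simp_all

lemma core (hG : IsCCC G) (hG' : IsCCC G') {f : Bdry G → Bdry G'} (hmob : Mobius G G' f)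
    {p : V} {p' : V'} {x1 x2 x0 : Bdry G} (c : Cfg G p x1 x2 x0)
    (c' : Cfg0 G' p' (f x1) (f x2) (f x0)) (u v : Bdry G)
    (hu : AtMost1 (grom G p x0.1 u.1) (grom G p x2.1 u.1) (grom G p x1.1 u.1))
    {n : ℕ} (hn : n ≠ 0)
    (a0 : grom G' p' (f x0).1 (f u).1 = grom G p x0.1 u.1 + n)
    (a1 : grom G' p' (f x1).1 (f u).1 = grom G p x1.1 u.1 + n)
    (a2 : grom G' p' (f x2).1 (f u).1 = grom G p x2.1 u.1 + n)
    (b0 : grom G' p' (f x0).1 (f v).1 = grom G p x0.1 v.1)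
    (b1 : grom G' p' (f x1).1 (f v).1 = grom G p x1.1 v.1)
    (b2 : grom G' p' (f x2).1 (f v).1 = grom G p x2.1 v.1)
    (v0 : grom G p x0.1 v.1 = 0) (v2 : grom G p x2.1 v.1 = 0)
    (uv : grom G' p' (f u).1 (f v).1 = 0)
    (hch : ∀ h ∈ (f v).1, p' ∉ h → ∀ k ∈ (f v).1, p' ∉ k → h ⊆ k ∨ k ⊆ h) : False := by
  have cu : ∀ y : Bdry G, grom G p u.1 y.1 = grom G p y.1 u.1 := fun y => grom_comm _ _ _
  have cv : ∀ y : Bdry G, grom G p v.1 y.1 = grom G p y.1 v.1 := fun y => grom_comm _ _ _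
  have cu' : ∀ y : Bdry G', grom G' p' (f u).1 y.1 = grom G' p' y.1 (f u).1 :=
    fun y => grom_comm _ _ _
  have cv' : ∀ y : Bdry G', grom G' p' (f v).1 y.1 = grom G' p' y.1 (f v).1 :=
    fun y => grom_comm _ _ _
  have z02 : grom G p x0.1 x2.1 = 0 := by rw [grom_comm]; exact c.z20
  have z01 : grom G p x0.1 x1.1 = 0 := by rw [grom_comm]; exact c.z10
  have z02' : grom G' p' (f x0).1 (f x2).1 = 0 := by rw [grom_comm]; exact c'.z20
  have z01' : grom G' p' (f x0).1 (f x1).1 = 0 := by rw [grom_comm]; exact c'.z10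
  rw [v0] at b0
  rw [v2] at b2
  -- the three tuples
  have T02 : ¬ AtMost1 (grom G p u.1 v.1) (grom G p x0.1 u.1) (grom G p x2.1 u.1) := by
    intro hA
    refine tuple_contra hn a0 a2 hA.right
      (mob_rel hG hmob u v x0 x2 p p' ?_ ?_ ?_ ?_ ?_ ?_ hA)
    · rw [z02, add_zero]
    · rw [cu, cv, v2, add_zero]
    · rw [cu, cv, v0, add_zero]
    · rw [uv, z02', add_zero]
    · rw [cu', cv', b2, add_zero]
    · rw [cu', cv', b0, add_zero]
  have T01 : ¬ AtMost1 (grom G p u.1 v.1) (grom G p x0.1 u.1 + grom G p x1.1 v.1)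
      (grom G p x1.1 u.1) := by
    intro hA
    refine tuple_contra hn (a' := grom G' p' (f x0).1 (f u).1 + grom G' p' (f x1).1 (f v).1)
      (by rw [a0, b1, add_right_comm]) a1 hA.right
      (mob_rel hG hmob u v x0 x1 p p' ?_ ?_ ?_ ?_ ?_ ?_ hA)
    · rw [z01, add_zero]
    · rw [cu, cv]
    · rw [cu, cv, v0, add_zero]
    · rw [uv, z01', add_zero]
    · rw [cu', cv']
    · rw [cu', cv', b0, add_zero]
  have T12 : ¬ AtMost1 (grom G p u.1 v.1) (grom G p x1.1 u.1)
      (grom G p x2.1 u.1 + grom G p x1.1 v.1) := by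
    intro hA
    refine tuple_contra hn (b' := grom G' p' (f x2).1 (f u).1 + grom G' p' (f x1).1 (f v).1)
      a1 (by rw [a2, b1, add_right_comm]) hA.right
      (mob_rel hG hmob u v x1 x2 p p' ?_ ?_ ?_ ?_ ?_ ?_ hA)
    · rw [c.z12, add_zero]
    · rw [cu, cv, v2, add_zero]
    · rw [cu, cv]
    · rw [uv, c'.z12, add_zero]
    · rw [cu', cv', b2, add_zero]
    · rw [cu', cv']
  simp only [AtMost1, ne_eq, ENat.add_eq_top] at T02 T01 T12 hu
  -- the auxiliary point
  have fin : ∀ z : Bdry G, grom G p z.1 v.1 = ⊤ → grom G p x1.1 v.1 = ⊤ →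
      grom G p x0.1 z.1 ≠ ⊤ → grom G p x1.1 z.1 ≠ ⊤ → grom G p x2.1 z.1 ≠ ⊤ → False := by
    intro z zv w1 z0 z1 z2
    obtain ⟨k, -, e1, -⟩ := defect hG hmob c c' z (Or.inl ⟨z0, z2⟩)
    have r := mob_rel hG hmob z v x0 x2 p p' rfl rfl rfl rfl rfl rfl (Or.inr (Or.inr
      ⟨by rw [cv, v2, add_zero, grom_comm]; exact z0,
       by rw [cv, v0, add_zero, grom_comm]; exact z2⟩))
    have t := r.top1 (by rw [zv, top_add])
    rw [z02', add_zero] at t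
    have := straight_top hG' (f x1).2.1 hch (by rw [b1, w1]) t (f z).2.1
    rw [e1, ENat.add_eq_top] at this
    simp [z1] at this
  obtain ⟨hγ, hβ, hcase⟩ := prop_cases hu T02 T01 T12
  have build : ∀ y : Bdry G, ∃ z : Bdry G, z.1 = med y.1 v.1 u.1 ∧ grom G p z.1 v.1 = ⊤ := by
    intro y
    have hU := med_ultra y.2.1 v.2.1 u.2.1
    have ht : grom G p (med y.1 v.1 u.1) v.1 = ⊤ := by
      rw [grom_top_iff] at hγ ⊢
      exact hγ.mono (fun h hh => ⟨Or.inl (Or.inr ⟨hh.2.1, hh.1⟩), hh.2.1, hh.2.2⟩)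
    exact ⟨⟨_, bdry_of_inf hG hU p ht⟩, rfl, ht⟩
  -- finiteness for medians
  have mfin : ∀ y z t : Bdry G, z.1 = med y.1 v.1 u.1 →
      (grom G p t.1 u.1 ≠ ⊤ ∨ (grom G p t.1 v.1 ≠ ⊤ ∧ grom G p t.1 y.1 ≠ ⊤)) →
      (grom G p t.1 v.1 ≠ ⊤ ∨ grom G p t.1 y.1 ≠ ⊤) → grom G p t.1 z.1 ≠ ⊤ := by
    intro y z t hz h1 h2 hc
    simp only [ne_eq, grom_top_iff, Set.not_infinite] at h1 h2
    rw [grom_top_iff, hz] at hc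
    refine hc ?_
    rcases h1 with h1 | ⟨h1, h1'⟩
    · rcases h2 with h2 | h2
      · refine (h1.union h2).subset ?_
        rintro h ⟨k1, ((⟨k2, k3⟩ | ⟨k2, k3⟩) | ⟨k2, k3⟩), k4⟩
        · exact Or.inr ⟨k1, k3, k4⟩
        · exact Or.inl ⟨k1, k3, k4⟩
        · exact Or.inl ⟨k1, k2, k4⟩
      · refine (h1.union h2).subset ?_
        rintro h ⟨k1, ((⟨k2, k3⟩ | ⟨k2, k3⟩) | ⟨k2, k3⟩), k4⟩
        · exact Or.inr ⟨k1, k2, k4⟩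
        · exact Or.inl ⟨k1, k3, k4⟩
        · exact Or.inl ⟨k1, k2, k4⟩
    · refine (h1.union h1').subset ?_
      rintro h ⟨k1, ((⟨k2, k3⟩ | ⟨k2, k3⟩) | ⟨k2, k3⟩), k4⟩
      · exact Or.inl ⟨k1, k3, k4⟩
      · exact Or.inl ⟨k1, k2, k4⟩
      · exact Or.inr ⟨k1, k3, k4⟩
  have nt : (0 : ℕ∞) ≠ ⊤ := by simp
  rcases hcase with ⟨h2, h0, h1⟩ | ⟨h2, h0, h1⟩
  · obtain ⟨z, hz, zv⟩ := build x0
    refine fin z zv hβ (mfin x0 z x0 hz (Or.inl h0) (Or.inl (v0 ▸ nt)))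
      (mfin x0 z x1 hz (Or.inl h1) (Or.inr (c.z10 ▸ nt)))
      (mfin x0 z x2 hz (Or.inr ⟨v2 ▸ nt, c.z20 ▸ nt⟩) (Or.inl (v2 ▸ nt)))
  · obtain ⟨z, hz, zv⟩ := build x2
    refine fin z zv hβ (mfin x2 z x0 hz (Or.inr ⟨v0 ▸ nt, z02 ▸ nt⟩) (Or.inl (v0 ▸ nt)))
      (mfin x2 z x1 hz (Or.inl h1) (Or.inr (c.z12 ▸ nt)))
      (mfin x2 z x2 hz (Or.inl h2) (Or.inl (v2 ▸ nt)))

lemma defect_zero (hG : IsCCC G) (hG' : IsCCC G') (hne : NoExtremal G) (hne' : NoExtremal G')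
    {f : Bdry G → Bdry G'} (hbij : Function.Bijective f) (hmob : Mobius G G' f)
    {p : V} {p' : V'} {x1 x2 x0 : Bdry G} (c : Cfg G p x1 x2 x0)
    (c' : Cfg0 G' p' (f x1) (f x2) (f x0)) (u : Bdry G)
    (hu : AtMost1 (grom G p x0.1 u.1) (grom G p x2.1 u.1) (grom G p x1.1 u.1))
    {n : ℕ}
    (a0 : grom G' p' (f x0).1 (f u).1 = grom G p x0.1 u.1 + n)
    (a1 : grom G' p' (f x1).1 (f u).1 = grom G p x1.1 u.1 + n)
    (a2 : grom G' p' (f x2).1 (f u).1 = grom G p x2.1 u.1 + n) : n = 0 := by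
  by_contra hn
  have hnz : grom G' p' (f x0).1 (f u).1 ≠ 0 := by
    rw [a0]; simp [hn]
  obtain ⟨a, ha, j0, ju⟩ := exists_common_adj hG' (f x0).2.1 (f u).2.1 hnz
  obtain ⟨e, d, he, hdis, hsub, hch⟩ := exists_straight hG' hne' ha
  obtain ⟨v, rfl⟩ := hbij.2 d
  have g0 := grom_zero_of_straight (f x0).2.1 hdis hsub j0
  have gu := grom_zero_of_straight (f u).2.1 hdis hsub ju
  have g12 : grom G' p' (f x1).1 (f v).1 = 0 ∨ grom G' p' (f x2).1 (f v).1 = 0 := by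
    by_contra hc
    push Not at hc
    obtain ⟨h1, h2⟩ := hc
    rw [Ne, grom_zero_iff] at h1 h2
    push Not at h1 h2
    obtain ⟨h, q1, q2, q3⟩ := h1
    obtain ⟨k, r1, r2, r3⟩ := h2
    rcases hch h q2 q3 k r2 r3 with hs | hs
    · exact r3 (grom_zero_iff.1 c'.z12 k (ultra_up (f x1).2.1 q1 ((f x2).2.1.1 k r1) hs) r1)
    · exact q3 (grom_zero_iff.1 c'.z12 h q1 (ultra_up (f x2).2.1 r1 ((f x1).2.1.1 h q1) hs))
  have nt : (0 : ℕ∞) ≠ ⊤ := by simp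
  have hv : AtMost1 (grom G p x0.1 v.1) (grom G p x2.1 v.1) (grom G p x1.1 v.1) := by
    have B1 := bad_top hG hne hmob (p' := p') c v
    have B2 := bad_top hG hne hmob (p' := p') c.symm v
    rw [g0] at B1 B2
    unfold AtMost1
    rcases c.zero v with h | h
    · have : grom G p x1.1 v.1 ≠ ⊤ := h ▸ nt
      tauto
    · have : grom G p x2.1 v.1 ≠ ⊤ := h ▸ nt
      tauto
  obtain ⟨k, e0, e1, e2⟩ := defect hG hmob c c' v hv
  have hk : k = 0 := by
    rw [g0] at e0
    have := (add_eq_zero.1 e0.symm).2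
    exact_mod_cast this
  subst hk
  simp only [Nat.cast_zero, add_zero] at e0 e1 e2
  have v0 : grom G p x0.1 v.1 = 0 := e0 ▸ g0
  rcases g12 with h | h
  · exact core hG hG' hmob c.symm c'.symm u v (by unfold AtMost1 at hu ⊢; tauto) hn a0 a2 a1
      e0 e2 e1 v0 (e1 ▸ h) gu hch
  · exact core hG hG' hmob c c' u v hu hn a0 a1 a2 e0 e1 e2 v0 (e2 ▸ h) gu hch

end main
end CCCR
open CCCR
/-- Lemma `order is preserved`: with `x1 op_x x2`, the median
`m'_x = m(f(x1), f(x2), f(x))` is a vertex of `Y`, and all three Gromov products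
based at `m_x` with any `u` such that `(x1,x2,x,u) ∈ 𝒜(X)` are preserved. -/
theorem stmt8 {V V' : Type*} (G : SimpleGraph V) (G' : SimpleGraph V')
    (hG : IsCCC G) (hG' : IsCCC G') (hne : NoExtremal G) (hne' : NoExtremal G')
    (f : Bdry G → Bdry G') (hbij : Function.Bijective f) (hmob : Mobius G G' f)
    (x1 x2 x : Bdry G) (hop : Op G x1.1 x2.1 x.1) :
    (∃ p' : V', med (f x1).1 (f x2).1 (f x).1 = princ G' p') ∧
    ∀ (p : V) (p' : V'), med x1.1 x2.1 x.1 = princ G p →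
      med (f x1).1 (f x2).1 (f x).1 = princ G' p' →
      ∀ u : Bdry G, memA G x1.1 x2.1 x.1 u.1 →
        grom G p x1.1 u.1 = grom G' p' (f x1).1 (f u).1 ∧
        grom G p x2.1 u.1 = grom G' p' (f x2).1 (f u).1 ∧
        grom G p x.1 u.1 = grom G' p' (f x).1 (f u).1 := by
  obtain ⟨⟨p0, hp0⟩, -⟩ := id hop
  have c0 : Cfg0 G p0 x1 x2 x := cfg0_of_med hp0
  have nt : (0 : ℕ∞) ≠ ⊤ := by simp
  refine ⟨?_, ?_⟩
  · obtain ⟨q'⟩ := hG'.1.nonempty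
    have s21 : grom G p0 x2.1 x1.1 = 0 := c0.symm.z12
    have s01 : grom G p0 x.1 x1.1 = 0 := by rw [grom_comm]; exact c0.z10
    have f12 := mob_fin hG hmob x2 x x1 p0 q' (s21 ▸ nt) (s01 ▸ nt)
    have f01 := mob_fin hG hmob x x2 x1 p0 q' (s01 ▸ nt) (s21 ▸ nt)
    have f20 := mob_fin hG hmob x2 x1 x p0 q' (c0.z20 ▸ nt) (c0.z10 ▸ nt)
    simp only [ne_eq, grom_top_iff, Set.not_infinite] at f12 f01 f20
    refine ultra_princ hG' (med_ultra (f x1).2.1 (f x2).2.1 (f x).2.1) (p := q') ?_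
    refine ((f12.union f01).union f20).subset ?_
    rintro h ⟨(⟨h1, h2⟩ | ⟨h1, h2⟩) | ⟨h1, h2⟩, h3⟩
    · exact Or.inl (Or.inl ⟨h2, h1, h3⟩)
    · exact Or.inr ⟨h1, h2, h3⟩
    · exact Or.inl (Or.inr ⟨h1, h2, h3⟩)
  · intro p p' hp hp' u hu
    have c : Cfg G p x1 x2 x := ⟨cfg0_of_med hp, fun h hh hph k hk hpk w hw h1 h2 =>
      op_disj hG x1.2.1 x2.2.1 hop hp hh hph hk hpk hw h1 h2⟩
    have c' : Cfg0 G' p' (f x1) (f x2) (f x) := cfg0_of_med hp'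
    have hA : AtMost1 (grom G p x.1 u.1) (grom G p x2.1 u.1) (grom G p x1.1 u.1) := by
      have := hu p
      simp only [inA, tripod] at this
      rw [c.z12, c.z10, c.z20, zero_add, zero_add, add_zero] at this
      exact this
    obtain ⟨n, a0, a1, a2⟩ := defect hG hmob c c' u hA
    have hn := defect_zero hG hG' hne hne' hbij hmob c c' u hA a0 a1 a2
    subst hn
    simp only [Nat.cast_zero, add_zero] at a0 a1 a2
    exact ⟨a1.symm, a2.symm, a0.symm⟩
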